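/- Let A be a simple unital C*-algebra with a unique tracial state τ, and let p ∈ M_n(A) and q ∈ M_m(A) be nonzero projections. Then 𝓕_p(A) = 𝓕_q(A), where 𝓕_p(A) = { (τ⊗Tr)(r)/(τ⊗Tr)(p) : k ∈ ℕ, r a nonzero projection in M_k(A) such that rM_k(A)r is *-isomorphic to pM_n(A)p }, and 𝓕_q(A) is defined analogously with q in place of p. -/

import Mathlib

open scoped ComplexOrder

/-- A *tracial state* on a unital C*-algebra `A` is a positive linear functional `τ` with
`τ(1) = 1` satisfying `τ(ab) = τ(ba)` for all `a b ∈ A`. -/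
def IsTracialState {A : Type*} [CStarAlgebra A] (τ : A →L[ℂ] ℂ) : Prop :=
  (∀ a : A, 0 ≤ τ (star a * a)) ∧ τ 1 = 1 ∧ ∀ a b : A, τ (a * b) = τ (b * a)

/-- The corner `p·M_n(A)·p` of the matrix algebra `M_n(A)` determined by a projection `p`
(`p * p = p`, `star p = p`), described as `{x | p * x = x ∧ x * p = x}` and bundled as a
non-unital star subalgebra of `M_n(A)`. -/
def corner {A : Type*} [CStarAlgebra A] {n : ℕ} (p : Matrix (Fin n) (Fin n) A)
    (hp : p * p = p) (hps : star p = p) :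
    NonUnitalStarSubalgebra ℂ (Matrix (Fin n) (Fin n) A) where
  carrier := {x | p * x = x ∧ x * p = x}
  add_mem' := fun hx hy => ⟨by rw [mul_add, hx.1, hy.1], by rw [add_mul, hx.2, hy.2]⟩
  zero_mem' := ⟨mul_zero p, zero_mul p⟩
  mul_mem' := fun {x y} hx hy => ⟨by rw [← mul_assoc, hx.1], by rw [mul_assoc, hy.2]⟩
  smul_mem' := fun c x hx => ⟨by rw [mul_smul_comm, hx.1], by rw [smul_mul_assoc, hx.2]⟩
  star_mem' := fun {x} hx =>
    ⟨by rw [← hps, ← star_mul, hx.2], by rw [← hps, ← star_mul, hx.1]⟩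


/-- The relative fundamental group `𝓕_p(A)`: the set of ratios `(τ⊗Tr)(r)/(τ⊗Tr)(p)` where `r`
ranges over the nonzero projections in some matrix algebra `M_k(A)` whose corner `r·M_k(A)·r`
is *-isomorphic to the corner `p·M_n(A)·p`. -/
noncomputable def relFundGroup {A : Type*} [CStarAlgebra A] (τ : A →L[ℂ] ℂ) {n : ℕ}
    (p : Matrix (Fin n) (Fin n) A) (hp : p * p = p) (hps : star p = p) : Set ℝ :=
  {t : ℝ | ∃ (k : ℕ) (r : Matrix (Fin k) (Fin k) A) (hr : r * r = r) (hrs : star r = r),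
    r ≠ 0 ∧ Nonempty ((corner r hr hrs) ≃⋆ₐ[ℂ] (corner p hp hps)) ∧
    t = (∑ i, τ (r i i)).re / (∑ i, τ (p i i)).re}

namespace RelFundGroup

open Matrix
open scoped Pointwise

section Algebraic

variable {A : Type*} [CStarAlgebra A]

/-- In a simple unital C*-algebra, a nonzero element generates the unit algebraically. -/
lemma one_mem_span_of_ne_zero
    (hsimple : ∀ I : TwoSidedIdeal A, IsClosed (I : Set A) → I = ⊥ ∨ I = ⊤)
    {a : A} (ha : a ≠ 0) : (1 : A) ∈ TwoSidedIdeal.span {a} := by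
  set I := TwoSidedIdeal.span {a}
  have haI : a ∈ I := TwoSidedIdeal.subset_span rfl
  let J : TwoSidedIdeal A := TwoSidedIdeal.mk' (closure (I : Set A))
    (subset_closure I.zero_mem)
    (fun hx hy => map_mem_closure₂ continuous_add hx hy fun _ h _ h' => I.add_mem h h')
    (fun hx => map_mem_closure continuous_neg hx fun _ h => I.neg_mem h)
    (fun {x _} hy => map_mem_closure (continuous_const_mul x) hy fun _ h => I.mul_mem_left _ _ h)
    (fun {_ y} hx => map_mem_closure (f := (· * y)) (continuous_mul_const y) hx
      fun _ h => I.mul_mem_right _ _ h)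
  have hJ : (J : Set A) = closure (I : Set A) := by
    ext x
    simp [J]
  have hJtop : J = ⊤ := by
    refine (hsimple J (hJ ▸ isClosed_closure)).resolve_left fun h => ha ?_
    have : a ∈ J := by
      rw [← SetLike.mem_coe, hJ]
      exact subset_closure haI
    rw [h] at this
    simpa [TwoSidedIdeal.mem_bot] using this
  have h1 : (1 : A) ∈ closure (I : Set A) := by
    rw [← hJ, hJtop]
    trivial
  obtain ⟨u, hu, huI⟩ := mem_closure_iff.1 h1 {x : A | IsUnit x} Units.isOpen isUnit_one
  obtain ⟨u, rfl⟩ := hu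
  simpa using I.mul_mem_left (↑u⁻¹ : A) _ huI

/-- In a simple unital C*-algebra, the unit is a finite sum of conjugates of any nonzero positive
element. -/
lemma exists_sum_star_mul_mul_eq_one
    (hsimple : ∀ I : TwoSidedIdeal A, IsClosed (I : Set A) → I = ⊥ ∨ I = ⊤)
    [PartialOrder A] [StarOrderedRing A] {a : A} (ha : 0 ≤ a) (ha0 : a ≠ 0) :
    ∃ (ι : Type) (_ : Fintype ι) (y : ι → A), ∑ l, star (y l) * a * y l = 1 := by
  have key : ∀ x ∈ AddSubgroup.closure ((Set.univ : Set A) * {a} * Set.univ),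
      ∃ (ι : Type) (_ : Fintype ι) (y : ι → A),
        x + star x ≤ ∑ l, star (y l) * a * y l ∧ -(x + star x) ≤ ∑ l, star (y l) * a * y l := by
    intro x hx
    induction hx using AddSubgroup.closure_induction with
    | mem x hx =>
      obtain ⟨_, ⟨b, -, d, hd, rfl⟩, c, -, rfl⟩ := hx
      obtain rfl : a = d := hd.symm
      have has : star a = a := (IsSelfAdjoint.of_nonneg ha).star_eq
      refine ⟨Bool, inferInstance, fun i => bif i then star b else c, ?_, ?_⟩
      · have := star_left_conjugate_nonneg ha (star b - c)
        rw [← sub_nonneg]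
        convert this using 1
        simp [has, mul_assoc]
        noncomm_ring
      · have := star_left_conjugate_nonneg ha (star b + c)
        rw [← sub_nonneg]
        convert this using 1
        simp [has, mul_assoc]
        noncomm_ring
    | zero => exact ⟨Empty, inferInstance, Empty.elim, by simp, by simp⟩
    | add x₁ x₂ _ _ h₁ h₂ =>
      obtain ⟨ι₁, _, y₁, h₁, h₁'⟩ := h₁
      obtain ⟨ι₂, _, y₂, h₂, h₂'⟩ := h₂
      refine ⟨ι₁ ⊕ ι₂, inferInstance, Sum.elim y₁ y₂, ?_, ?_⟩
      · simp only [Fintype.sum_sum_type, Sum.elim_inl, Sum.elim_inr]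
        convert add_le_add h₁ h₂ using 1
        rw [star_add]
        abel
      · simp only [Fintype.sum_sum_type, Sum.elim_inl, Sum.elim_inr]
        convert add_le_add h₁' h₂' using 1
        rw [star_add]
        abel
    | neg x _ h =>
      obtain ⟨ι, _, y, h, h'⟩ := h
      exact ⟨ι, inferInstance, y, by simpa [add_comm] using h', by simpa [add_comm] using h⟩
  obtain ⟨ι, _, y, hy, -⟩ := key 1
    (TwoSidedIdeal.mem_span_iff_mem_addSubgroup_closure.1 (one_mem_span_of_ne_zero hsimple ha0))
  set h := ∑ l, star (y l) * a * y l with hh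
  have h1 : (1 : A) ≤ h := le_trans (by simp) hy
  have h0 : 0 ≤ h := zero_le_one.trans h1
  have hu : IsUnit h := CStarAlgebra.isUnit_of_le 1 h1
  obtain ⟨w, hw⟩ : ∃ w : A, w = h ^ (-(1 / 2) : ℝ) := ⟨_, rfl⟩
  have hs : star w = w := hw ▸ (IsSelfAdjoint.of_nonneg CFC.rpow_nonneg).star_eq
  refine ⟨ι, inferInstance, fun l => y l * w, ?_⟩
  calc ∑ l, star (y l * w) * a * (y l * w) = w * h * w := by
        rw [hh, Finset.mul_sum, Finset.sum_mul]
        simp only [star_mul, hs, mul_assoc]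
    _ = w * h ^ (1 : ℝ) * w := by rw [CFC.rpow_one h]
    _ = 1 := by
        rw [hw, ← CFC.rpow_add hu, ← CFC.rpow_add hu]
        norm_num [CFC.rpow_zero h]

/-- A nonzero projection in `M_n(A)`, with `A` simple, is full: the unit of `M_κ(A)` is a sum of
elements `v⋆v` with `p v = v`. -/
lemma exists_sum_conjTranspose_mul_eq_one
    (hsimple : ∀ I : TwoSidedIdeal A, IsClosed (I : Set A) → I = ⊥ ∨ I = ⊤)
    {n : ℕ} {p : Matrix (Fin n) (Fin n) A} (hp : p * p = p) (hps : star p = p) (hpne : p ≠ 0)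
    (κ : Type) [Fintype κ] [DecidableEq κ] :
    ∃ (ι : Type) (_ : Fintype ι) (v : ι → Matrix (Fin n) κ A),
      (∀ l, p * v l = v l) ∧ ∑ l, (v l)ᴴ * v l = 1 := by
  let := CStarAlgebra.spectralOrder A
  let := CStarAlgebra.spectralOrderedRing A
  have hpij (i j) : star (p i j) = p j i := congrFun₂ hps j i
  have hdiag (j : Fin n) : ∑ i, star (p i j) * p i j = p j j := by
    simp only [hpij]
    exact congrFun₂ hp j j
  have hpp (i j) : ∑ k, p i k * p k j = p i j := congrFun₂ hp i j
  obtain ⟨j, hj⟩ : ∃ j, p j j ≠ 0 := by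
    by_contra! h
    refine hpne (Matrix.ext fun i j => ?_)
    have h2 := hdiag j
    rw [h j, Finset.sum_eq_zero_iff_of_nonneg fun i _ => star_mul_self_nonneg _] at h2
    simpa using h2 i (Finset.mem_univ i)
  have hj0 : 0 ≤ p j j := hdiag j ▸ Finset.sum_nonneg fun i _ => star_mul_self_nonneg _
  obtain ⟨ι, _, y, hy⟩ := exists_sum_star_mul_mul_eq_one hsimple hj0 hj
  refine ⟨ι × κ, inferInstance,
    fun l => of fun i k => if k = l.2 then p i j * y l.1 else 0, fun l => ?_, ?_⟩
  · ext i k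
    by_cases hk : k = l.2
    · simp [mul_apply, hk, ← mul_assoc, ← Finset.sum_mul, hpp]
    · simp [mul_apply, hk]
  · ext k₁ k₂
    have hc (l : ι) : ∑ i, star (p i j * y l) * (p i j * y l) = star (y l) * p j j * y l := by
      rw [← hdiag, Finset.mul_sum, Finset.sum_mul]
      simp [mul_assoc]
    by_cases hk : k₁ = k₂
    · subst hk
      rw [Matrix.sum_apply, Fintype.sum_prod_type]
      simp [mul_apply, apply_ite star, -star_mul, hc, hy]
    · rw [Matrix.sum_apply, Matrix.one_apply_ne hk]
      refine Finset.sum_eq_zero fun l _ => ?_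
      simp only [mul_apply, conjTranspose_apply, of_apply]
      refine Finset.sum_eq_zero fun i _ => ?_
      by_cases h1 : k₁ = l.2
      · simp [show k₂ ≠ l.2 from fun h => hk (h1.trans h.symm)]
      · simp [h1]

end Algebraic

section Trace

variable {A : Type*} [CStarAlgebra A]

/-- The functional `τ ⊗ Tr` on `M_κ(A)`. -/
noncomputable def matTrace (τ : A →L[ℂ] ℂ) {κ : Type} [Fintype κ] : Matrix κ κ A →ₗ[ℂ] ℂ :=
  (τ : A →ₗ[ℂ] ℂ) ∘ₗ Matrix.traceLinearMap κ ℂ A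

variable {τ : A →L[ℂ] ℂ} {κ κ' : Type} [Fintype κ] [Fintype κ']

lemma matTrace_apply (x : Matrix κ κ A) : matTrace τ x = ∑ i, τ (x i i) := by
  simp [matTrace, Matrix.trace]

lemma matTrace_mul_comm (hτ : IsTracialState τ) (x : Matrix κ κ' A) (y : Matrix κ' κ A) :
    matTrace τ (x * y) = matTrace τ (y * x) := by
  simp only [matTrace_apply, mul_apply, map_sum]
  rw [Finset.sum_comm]
  simp only [hτ.2.2 (x _ _)]

lemma matTrace_conjTranspose_mul_self_nonneg (hτ : IsTracialState τ) (x : Matrix κ κ' A) :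
    0 ≤ matTrace τ (xᴴ * x) := by
  simp only [matTrace_apply, mul_apply, map_sum]
  exact Finset.sum_nonneg fun _ _ => Finset.sum_nonneg fun _ _ => hτ.1 _

/-- A linear functional that is nonnegative on all `a⋆a`, as a positive linear map. -/
lemma exists_positiveLinearMap [PartialOrder A] [StarOrderedRing A] (f : A →ₗ[ℂ] ℂ)
    (hf : ∀ a, 0 ≤ f (star a * a)) : ∃ g : A →ₚ[ℂ] ℂ, ∀ a, g a = f a := by
  refine ⟨PositiveLinearMap.mk₀ f fun a ha => ?_, fun a => rfl⟩
  obtain ⟨b, rfl⟩ := CStarAlgebra.nonneg_iff_eq_star_mul_self.1 ha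
  exact hf b

/-- A positive tracial functional is a nonnegative multiple of the unique tracial state. -/
lemma eq_mul_of_tracial (hτ : IsTracialState τ)
    (huniq : ∀ σ : A →L[ℂ] ℂ, IsTracialState σ → σ = τ) (f : A →ₗ[ℂ] ℂ)
    (hf : ∀ a, 0 ≤ f (star a * a)) (hf' : ∀ a b, f (a * b) = f (b * a)) :
    ∃ c : ℝ, ∀ a, f a = c * τ a := by
  let := CStarAlgebra.spectralOrder A
  let := CStarAlgebra.spectralOrderedRing A
  obtain ⟨g, hg⟩ := exists_positiveLinearMap f hf
  have h1 : 0 ≤ f 1 := by simpa using hf 1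
  obtain ⟨c, hc, hc'⟩ : ∃ c : ℝ, 0 ≤ c ∧ (c : ℂ) = f 1 := by
    rw [Complex.nonneg_iff] at h1
    exact ⟨(f 1).re, h1.1, Complex.ext rfl (by simpa using h1.2)⟩
  have hc0 : ((1 + c : ℝ) : ℂ) ≠ 0 := by
    exact_mod_cast (by positivity : (1 + c : ℝ) ≠ 0)
  let F : A →L[ℂ] ℂ := ⟨f, (map_continuous g).congr hg⟩
  have hF (a : A) : F a = f a := rfl
  have := huniq (((1 + c : ℝ) : ℂ)⁻¹ • (τ + F)) ⟨fun a => ?_, ?_, fun a b => ?_⟩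
  · refine ⟨c, fun a => ?_⟩
    have := congr($this a)
    simp only [_root_.smul_apply, _root_.add_apply, hF,
      smul_eq_mul, inv_mul_eq_iff_eq_mul₀ hc0] at this
    push_cast at this
    linear_combination this
  · have : (0 : ℂ) ≤ ((1 + c : ℝ) : ℂ)⁻¹ := by
      rw [← Complex.ofReal_inv]
      exact Complex.zero_le_real.2 (by positivity)
    exact mul_nonneg this (add_nonneg (hτ.1 a) (hf a))
  · simp only [_root_.smul_apply, _root_.add_apply, hF,
      smul_eq_mul, hτ.2.1, ← hc']
    push_cast at hc0 ⊢
    exact inv_mul_cancel₀ hc0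
  · simp only [_root_.smul_apply, _root_.add_apply, hF, hτ.2.2 a b,
      hf' a b]

/-- `τ ⊗ Tr` does not vanish on nonzero projections. -/
lemma matTrace_re_ne_zero
    (hsimple : ∀ I : TwoSidedIdeal A, IsClosed (I : Set A) → I = ⊥ ∨ I = ⊤)
    (hτ : IsTracialState τ) {n : ℕ} {p : Matrix (Fin n) (Fin n) A} (hp : p * p = p)
    (hps : star p = p) (hpne : p ≠ 0) : (matTrace τ p).re ≠ 0 := by
  let := CStarAlgebra.spectralOrder A
  let := CStarAlgebra.spectralOrderedRing A
  intro hre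
  have hpp : pᴴ * p = p := by rw [← star_eq_conjTranspose, hps, hp]
  have h0 : matTrace τ p = 0 := by
    have := matTrace_conjTranspose_mul_self_nonneg hτ p
    rw [hpp, Complex.nonneg_iff] at this
    exact Complex.ext hre this.2.symm
  have hent (i j) : τ (star (p i j) * p i j) = 0 := by
    rw [← hpp, matTrace_apply] at h0
    simp only [mul_apply, map_sum, conjTranspose_apply] at h0
    rw [Finset.sum_eq_zero_iff_of_nonneg fun _ _ => Finset.sum_nonneg fun _ _ => hτ.1 _] at h0
    have := h0 j (Finset.mem_univ j)
    rw [Finset.sum_eq_zero_iff_of_nonneg fun _ _ => hτ.1 _] at this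
    exact this i (Finset.mem_univ i)
  obtain ⟨g, hg⟩ := exists_positiveLinearMap (τ : A →ₗ[ℂ] ℂ) hτ.1
  have hcs (i j) (b : A) : τ (star (p i j) * b) = 0 := by
    have h1 : ‖g.toPreGNS (p i j)‖ = 0 := by
      rw [g.preGNS_norm_def, g.ofPreGNS_toPreGNS, hg]
      simp [hent]
    have h2 := norm_inner_le_norm (𝕜 := ℂ) (g.toPreGNS (p i j)) (g.toPreGNS b)
    rw [h1, zero_mul, g.preGNS_inner_def, g.ofPreGNS_toPreGNS, g.ofPreGNS_toPreGNS, hg] at h2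
    simpa using h2
  have hpx (x : Matrix (Fin n) (Fin n) A) : matTrace τ (p * x) = 0 := by
    rw [← hps, matTrace_apply]
    simp [mul_apply, hcs]
  obtain ⟨ι, _, v, hv, hv1⟩ := exists_sum_conjTranspose_mul_eq_one hsimple hp hps hpne Unit
  have h1 : matTrace τ (1 : Matrix Unit Unit A) = 1 := by simp [matTrace_apply, hτ.2.1]
  rw [← hv1, map_sum, Finset.sum_eq_zero] at h1
  · exact zero_ne_one h1
  · intro l _
    rw [matTrace_mul_comm hτ, ← hv l, Matrix.mul_assoc, hpx]

/-- Every positive tracial functional on the corner of a nonzero projection is proportional to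
`τ ⊗ Tr`. -/
lemma exists_eq_mul_matTrace
    (hsimple : ∀ I : TwoSidedIdeal A, IsClosed (I : Set A) → I = ⊥ ∨ I = ⊤)
    (hτ : IsTracialState τ) (huniq : ∀ σ : A →L[ℂ] ℂ, IsTracialState σ → σ = τ)
    {n : ℕ} {p : Matrix (Fin n) (Fin n) A} (hp : p * p = p) (hps : star p = p) (hpne : p ≠ 0)
    (σ : Matrix (Fin n) (Fin n) A →ₗ[ℂ] ℂ)
    (hσ : ∀ x ∈ corner p hp hps, 0 ≤ σ (star x * x))
    (hσ' : ∀ x ∈ corner p hp hps, ∀ y ∈ corner p hp hps, σ (x * y) = σ (y * x)) :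
    ∃ c : ℝ, ∀ x ∈ corner p hp hps, σ x = c * matTrace τ x := by
  obtain ⟨ι, _, v, hv, hv1⟩ := exists_sum_conjTranspose_mul_eq_one hsimple hp hps hpne Unit
  have hv' (l) : (v l)ᴴ * p = (v l)ᴴ := by
    rw [← hps, star_eq_conjTranspose, ← conjTranspose_mul, hv]
  let d : A →ₗ[ℂ] Matrix Unit Unit A :=
    { toFun := fun a => of fun _ _ => a
      map_add' := fun _ _ => rfl
      map_smul' := fun _ _ => rfl }
  have hd_apply (a : A) (i j) : d a i j = a := rfl
  have hd_mul (a b : A) : d (a * b) = d a * d b := by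
    ext
    simp [hd_apply, mul_apply]
  have hd_star (a : A) : d (star a) = (d a)ᴴ := rfl
  let f : A →ₗ[ℂ] ℂ :=
    { toFun := fun a => ∑ l, σ (v l * d a * (v l)ᴴ)
      map_add' := fun a b => by
        simp [Matrix.mul_add, Matrix.add_mul, Finset.sum_add_distrib]
      map_smul' := fun c a => by
        simp [Finset.mul_sum] }
  have hf_apply (a : A) : f a = ∑ l, σ (v l * d a * (v l)ᴴ) := rfl
  have hmem (l m) (a : A) : v l * d a * (v m)ᴴ ∈ corner p hp hps :=
    ⟨by rw [← Matrix.mul_assoc, ← Matrix.mul_assoc, hv], by rw [Matrix.mul_assoc, hv']⟩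
  have hf_mul (a b : A) :
      f (a * b) = ∑ l, ∑ m, σ ((v l * d a * (v m)ᴴ) * (v m * d b * (v l)ᴴ)) := by
    rw [hf_apply]
    refine Finset.sum_congr rfl fun l _ => ?_
    rw [← map_sum]
    congr 1
    calc v l * d (a * b) * (v l)ᴴ = v l * d a * (∑ m, (v m)ᴴ * v m) * (d b * (v l)ᴴ) := by
          rw [hv1, hd_mul, Matrix.mul_one]
          simp only [Matrix.mul_assoc]
      _ = _ := by
          simp only [Matrix.mul_sum, Matrix.sum_mul, Matrix.mul_assoc]
  obtain ⟨c, hc⟩ := eq_mul_of_tracial hτ huniq f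
    (fun a => by
      rw [hf_mul]
      refine Finset.sum_nonneg fun l _ => Finset.sum_nonneg fun m _ => ?_
      convert hσ _ (hmem m l a) using 3
      simp [star_eq_conjTranspose, hd_star, Matrix.mul_assoc])
    (fun a b => by
      rw [hf_mul, hf_mul, Finset.sum_comm]
      exact Finset.sum_congr rfl fun l _ => Finset.sum_congr rfl fun m _ =>
        hσ' _ (hmem _ _ _) _ (hmem _ _ _))
  refine ⟨c, fun x hx => ?_⟩
  let e (i : Fin n) : Matrix Unit (Fin n) A := of fun _ j => if j = i then 1 else 0
  have he : ∑ i, (e i)ᴴ * e i = 1 := by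
    ext j k
    simp [Matrix.sum_apply, mul_apply, e, apply_ite star, Matrix.one_apply, eq_comm]
  have hex (i) : e i * x * (e i)ᴴ = d (x i i) := by
    ext
    simp [mul_apply, e, hd_apply, apply_ite star]
  have hx1 (i l) : x * (e i)ᴴ * (v l)ᴴ ∈ corner p hp hps :=
    ⟨by rw [← Matrix.mul_assoc, ← Matrix.mul_assoc, hx.1], by rw [Matrix.mul_assoc, hv']⟩
  have hx2 (i l) : v l * e i * p ∈ corner p hp hps :=
    ⟨by rw [← Matrix.mul_assoc, ← Matrix.mul_assoc, hv], by rw [Matrix.mul_assoc, hp]⟩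
  have hxsum : x = ∑ i, ∑ l, (x * (e i)ᴴ * (v l)ᴴ) * (v l * e i * p) := by
    calc x = x * (∑ i, (e i)ᴴ * (∑ l, (v l)ᴴ * v l) * e i) * p := by
          simp only [hv1, Matrix.mul_one, he]
          exact hx.2.symm
      _ = _ := by
          simp only [Matrix.mul_sum, Matrix.sum_mul, Matrix.mul_assoc]
  rw [hxsum, map_sum, ← hxsum, matTrace_apply, Finset.mul_sum]
  refine Finset.sum_congr rfl fun i _ => ?_
  rw [map_sum, ← hc, hf_apply]
  refine Finset.sum_congr rfl fun l _ => ?_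
  rw [hσ' _ (hx1 i l) _ (hx2 i l), ← hex]
  congr 1
  rw [Matrix.mul_assoc _ p, ← Matrix.mul_assoc p, ← Matrix.mul_assoc p, hx.1]
  simp only [Matrix.mul_assoc]

end Trace

section Corner

variable {A : Type*} [CStarAlgebra A]

/-- An isomorphism of corners is the restriction of a linear map between the matrix algebras. -/
lemma exists_linearMap_extension {n k : ℕ} {p : Matrix (Fin n) (Fin n) A} {hp : p * p = p}
    {hps : star p = p} {r : Matrix (Fin k) (Fin k) A} {hr : r * r = r} {hrs : star r = r}
    (e : corner p hp hps ≃⋆ₐ[ℂ] corner r hr hrs) :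
    ∃ f : Matrix (Fin n) (Fin n) A →ₗ[ℂ] Matrix (Fin k) (Fin k) A,
      (∀ x : corner p hp hps, f x = e x) ∧
      (∀ x ∈ corner p hp hps, ∀ y ∈ corner p hp hps, f (x * y) = f x * f y) ∧
      ∀ x ∈ corner p hp hps, f (star x) = star (f x) := by
  let g : Matrix (Fin n) (Fin n) A →ₗ[ℂ] corner p hp hps :=
    { toFun := fun x => ⟨p * x * p, by rw [← mul_assoc, ← mul_assoc, hp],
        by rw [mul_assoc, hp]⟩
      map_add' := fun x y => Subtype.ext (by simp [mul_add, add_mul])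
      map_smul' := fun c x => Subtype.ext (by simp) }
  have hg (x : corner p hp hps) : g x = x :=
    Subtype.ext (show p * x.1 * p = x.1 by rw [x.2.1, x.2.2])
  let f : Matrix (Fin n) (Fin n) A →ₗ[ℂ] Matrix (Fin k) (Fin k) A :=
    { toFun := fun x => e (g x)
      map_add' := fun x y => by rw [map_add, map_add]; rfl
      map_smul' := fun c x => by rw [map_smul, map_smul]; rfl }
  have hf (x : corner p hp hps) : f x = e x :=
    congr(((e $(hg x) : corner r hr hrs) : Matrix (Fin k) (Fin k) A))
  refine ⟨f, hf, fun x hx y hy => ?_, fun x hx => ?_⟩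
  · rw [hf ⟨x, hx⟩, hf ⟨y, hy⟩, ← NonUnitalStarSubalgebra.coe_mul, ← map_mul, ← hf]
    rfl
  · have := hf (star ⟨x, hx⟩)
    rw [map_star] at this
    rw [hf ⟨x, hx⟩]
    exact this

/-- A linear map that restricts to a bijective `*`-homomorphism between corners gives an
isomorphism of the corners. -/
lemma nonempty_corner_starAlgEquiv {m K : ℕ} {q : Matrix (Fin m) (Fin m) A} (hq : q * q = q)
    (hqs : star q = q) {s : Matrix (Fin K) (Fin K) A} (hs : s * s = s) (hss : star s = s)
    (f : Matrix (Fin m) (Fin m) A →ₗ[ℂ] Matrix (Fin K) (Fin K) A)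
    (hfmem : ∀ x ∈ corner q hq hqs, f x ∈ corner s hs hss)
    (hfmul : ∀ x ∈ corner q hq hqs, ∀ y ∈ corner q hq hqs, f (x * y) = f x * f y)
    (hfstar : ∀ x ∈ corner q hq hqs, f (star x) = star (f x))
    (hfinj : ∀ x ∈ corner q hq hqs, f x = 0 → x = 0)
    (hfsurj : ∀ z ∈ corner s hs hss, ∃ x ∈ corner q hq hqs, f x = z) :
    Nonempty (corner s hs hss ≃⋆ₐ[ℂ] corner q hq hqs) := by
  let F : corner q hq hqs →⋆ₙₐ[ℂ] corner s hs hss :=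
    { toFun := fun x => ⟨f x, hfmem x x.2⟩
      map_smul' := fun c x => Subtype.ext (map_smul f c (x : Matrix (Fin m) (Fin m) A))
      map_zero' := Subtype.ext (map_zero f)
      map_add' := fun x y => Subtype.ext (map_add f (x : Matrix (Fin m) (Fin m) A) y)
      map_mul' := fun x y => Subtype.ext (hfmul x x.2 y y.2)
      map_star' := fun x => Subtype.ext (hfstar x x.2) }
  refine ⟨(StarAlgEquiv.ofBijective F ⟨?_, ?_⟩).symm⟩
  · refine (injective_iff_map_eq_zero F).2 fun x hx => Subtype.ext ?_
    exact hfinj x x.2 congr(($hx : Matrix (Fin K) (Fin K) A))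
  · rintro ⟨z, hz⟩
    obtain ⟨x, hx, rfl⟩ := hfsurj z hz
    exact ⟨⟨x, hx⟩, rfl⟩

/-- A unital embedding of `q M_m(A) q` as a corner of a matrix algebra over `p M_n(A) p` can be
transported along an isomorphism of `p M_n(A) p` with another corner `r M_k(A) r`. -/
lemma exists_projection_of_corner_starAlgEquiv {n m k : ℕ}
    {p : Matrix (Fin n) (Fin n) A} {hp : p * p = p} {hps : star p = p}
    {q : Matrix (Fin m) (Fin m) A} (hq : q * q = q) (hqs : star q = q)
    {r : Matrix (Fin k) (Fin k) A} {hr : r * r = r} {hrs : star r = r}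
    (φ : corner p hp hps ≃⋆ₐ[ℂ] corner r hr hrs)
    {ψ : Matrix (Fin n) (Fin n) A →ₗ[ℂ] Matrix (Fin k) (Fin k) A}
    (hψ : ∀ x : corner p hp hps, ψ x = φ x)
    (hψ_mul : ∀ x ∈ corner p hp hps, ∀ y ∈ corner p hp hps, ψ (x * y) = ψ x * ψ y)
    (hψ_star : ∀ x ∈ corner p hp hps, ψ (star x) = star (ψ x))
    {ι : Type} [Fintype ι] {v : ι → Matrix (Fin n) (Fin m) A} (hv : ∀ l, p * v l = v l)
    (hvq : ∑ l, (v l)ᴴ * v l = q) (hvr : ∀ l, v l * q = v l) :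
    ∃ (K : ℕ) (s : Matrix (Fin K) (Fin K) A) (hs : s * s = s) (hss : star s = s),
      Nonempty (corner s hs hss ≃⋆ₐ[ℂ] corner q hq hqs) ∧
      ∀ τ : A →L[ℂ] ℂ, matTrace τ s = ∑ l, matTrace τ (ψ (v l * (v l)ᴴ)) := by
  have hv' (l) : (v l)ᴴ * p = (v l)ᴴ := by
    rw [← hps, star_eq_conjTranspose, ← conjTranspose_mul, hv]
  have hvr' (l) : q * (v l)ᴴ = (v l)ᴴ := by
    rw [← hqs, star_eq_conjTranspose, ← conjTranspose_mul, hvr]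
  have hmem (l l') (x : Matrix (Fin m) (Fin m) A) : v l * x * (v l')ᴴ ∈ corner p hp hps :=
    ⟨by rw [← Matrix.mul_assoc, ← Matrix.mul_assoc, hv], by rw [Matrix.mul_assoc, hv']⟩
  have hψ_mem (x) (hx : x ∈ corner p hp hps) : ψ x ∈ corner r hr hrs := by
    rw [hψ ⟨x, hx⟩]
    exact (φ ⟨x, hx⟩).2
  have hψ_inj (x) (hx : x ∈ corner p hp hps) (h : ψ x = 0) : x = 0 := by
    rw [hψ ⟨x, hx⟩] at h
    have h' : φ ⟨x, hx⟩ = 0 := Subtype.ext h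
    exact congrArg Subtype.val ((map_eq_zero_iff φ (EquivLike.injective φ)).1 h')
  have hψ_surj (z) (hz : z ∈ corner r hr hrs) : ∃ x ∈ corner p hp hps, ψ x = z := by
    refine ⟨φ.symm ⟨z, hz⟩, (φ.symm ⟨z, hz⟩).2, ?_⟩
    rw [hψ, StarAlgEquiv.apply_symm_apply]
  obtain ⟨K, ⟨e⟩⟩ : ∃ K, Nonempty (Fin K ≃ ι × Fin k) :=
    ⟨_, ⟨(Fintype.equivFin (ι × Fin k)).symm⟩⟩
  let f : Matrix (Fin m) (Fin m) A →ₗ[ℂ] Matrix (Fin K) (Fin K) A :=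
    { toFun := fun x => of fun i j => ψ (v (e i).1 * x * (v (e j).1)ᴴ) (e i).2 (e j).2
      map_add' := fun x y => by
        ext
        simp [Matrix.mul_add, Matrix.add_mul]
      map_smul' := fun c x => by
        ext
        simp }
  have hf (x i j) : f x i j = ψ (v (e i).1 * x * (v (e j).1)ᴴ) (e i).2 (e j).2 := rfl
  have hf' (x l a l' b) : f x (e.symm (l, a)) (e.symm (l', b)) = ψ (v l * x * (v l')ᴴ) a b := by
    simp [hf]
  let blk (z : Matrix (Fin K) (Fin K) A) (l l' : ι) : Matrix (Fin k) (Fin k) A :=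
    of fun a b => z (e.symm (l, a)) (e.symm (l', b))
  have hblk_mul (y z l l') : blk (y * z) l l' = ∑ l₁, blk y l l₁ * blk z l₁ l' := by
    ext a b
    simp only [blk, of_apply, mul_apply, Matrix.sum_apply]
    rw [← e.symm.sum_comp, Fintype.sum_prod_type]
  have hblk_ext (y z) (h : ∀ l l', blk y l l' = blk z l l') : y = z := by
    ext i j
    simpa [blk] using congr($(h (e i).1 (e j).1) (e i).2 (e j).2)
  have hblk_f (x l l') : blk (f x) l l' = ψ (v l * x * (v l')ᴴ) := by
    ext a b
    exact hf' x l a l' b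
  have hf_mul (x) (hx : x * q = x) (y) : f (x * y) = f x * f y := by
    refine hblk_ext _ _ fun l l' => ?_
    rw [hblk_mul]
    simp only [hblk_f]
    rw [← Finset.sum_congr rfl fun l₁ _ => hψ_mul _ (hmem l l₁ x) _ (hmem l₁ l' y), ← map_sum]
    congr 1
    calc v l * (x * y) * (v l')ᴴ
        = v l * x * (∑ l₁, (v l₁)ᴴ * v l₁) * y * (v l')ᴴ := by
          rw [hvq, Matrix.mul_assoc (v l) x q, hx]
          simp only [Matrix.mul_assoc]
      _ = _ := by
          simp only [Matrix.mul_sum, Matrix.sum_mul, Matrix.mul_assoc]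
  have hf_star (x) : f (star x) = star (f x) := by
    ext i j
    rw [star_eq_conjTranspose (f x), conjTranspose_apply, hf, hf, ← conjTranspose_apply,
      ← star_eq_conjTranspose (ψ _), ← hψ_star _ (hmem _ _ _)]
    simp [star_eq_conjTranspose, Matrix.mul_assoc]
  have hs : f q * f q = f q := by rw [← hf_mul q hq, hq]
  have hss : star (f q) = f q := by rw [← hf_star, hqs]
  refine ⟨K, f q, hs, hss, nonempty_corner_starAlgEquiv hq hqs hs hss f (fun x hx => ⟨?_, ?_⟩)
    (fun x hx y _ => hf_mul x hx.2 y) (fun x _ => hf_star x) (fun x hx h => ?_) (fun z hz => ?_),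
    fun τ => ?_⟩
  · rw [← hf_mul q hq, hx.1]
  · rw [← hf_mul x hx.2, hx.2]
  · have h0 (l l') : v l * x * (v l')ᴴ = 0 := by
      refine hψ_inj _ (hmem _ _ _) (Matrix.ext fun a b => ?_)
      rw [← hf', h]
      rfl
    calc x = q * x * q := by rw [hx.1, hx.2]
      _ = ∑ l, ∑ l', (v l)ᴴ * (v l * x * (v l')ᴴ) * v l' := by
          rw [← hvq]
          simp only [Matrix.mul_sum, Matrix.sum_mul, Matrix.mul_assoc]
          rw [Finset.sum_comm]
      _ = 0 := by simp [h0]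
  · have hS (l l') : blk (f q) l l' ∈ corner r hr hrs := hblk_f q l l' ▸ hψ_mem _ (hmem _ _ _)
    have hzmem (l l') : blk z l l' ∈ corner r hr hrs := by
      constructor
      · rw [← hz.1, hblk_mul]
        simp only [Matrix.mul_sum, ← Matrix.mul_assoc, (hS _ _).1]
      · rw [← hz.2, hblk_mul]
        simp only [Matrix.sum_mul, Matrix.mul_assoc, (hS _ _).2]
    choose X hX hXz using fun l l' => hψ_surj _ (hzmem l l')
    refine ⟨∑ l, ∑ l', (v l)ᴴ * X l l' * v l', ⟨?_, ?_⟩, hblk_ext _ _ fun l l' => ?_⟩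
    · simp only [Matrix.mul_sum, ← Matrix.mul_assoc, hvr']
    · simp only [Matrix.sum_mul, Matrix.mul_assoc, hvr]
    · conv_rhs => rw [← hz.1, ← hz.2, hblk_mul]
      rw [hblk_f]
      simp only [hblk_mul, hblk_f, Matrix.mul_sum, Matrix.sum_mul, map_sum]
      refine Finset.sum_congr rfl fun l₁ _ => Finset.sum_congr rfl fun l₂ _ => ?_
      rw [← hXz, ← hψ_mul _ (hX _ _) _ (hmem _ _ _),
        ← hψ_mul _ (hmem _ _ _) _ (mul_mem (hX _ _) (hmem _ _ _)), hvr, hvr]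
      simp only [Matrix.mul_assoc]
  · rw [matTrace_apply, ← e.symm.sum_comp, Fintype.sum_prod_type]
    simp [hf', hvr, matTrace_apply]

end Corner

/-- The inclusion of relative fundamental groups underlying `relFundGroup_eq`. -/
lemma relFundGroup_subset {A : Type*} [CStarAlgebra A]
    (hsimple : ∀ I : TwoSidedIdeal A, IsClosed (I : Set A) → I = ⊥ ∨ I = ⊤)
    (τ : A →L[ℂ] ℂ) (hτ : IsTracialState τ)
    (huniq : ∀ σ : A →L[ℂ] ℂ, IsTracialState σ → σ = τ)
    {n m : ℕ} (p : Matrix (Fin n) (Fin n) A) (hp : p * p = p) (hps : star p = p) (hpne : p ≠ 0)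
    (q : Matrix (Fin m) (Fin m) A) (hq : q * q = q) (hqs : star q = q) (hqne : q ≠ 0) :
    relFundGroup τ p hp hps ⊆ relFundGroup τ q hq hqs := by
  rintro t ⟨k, r, hr, hrs, -, ⟨φ⟩, rfl⟩
  obtain ⟨ψ, hψ, hψ_mul, hψ_star⟩ := exists_linearMap_extension φ.symm
  obtain ⟨ι, _, w, hw, hw1⟩ :=
    exists_sum_conjTranspose_mul_eq_one hsimple hp hps hpne (Fin m)
  have hvq : ∑ l, (w l * q)ᴴ * (w l * q) = q := by
    calc ∑ l, (w l * q)ᴴ * (w l * q) = star q * (∑ l, (w l)ᴴ * w l) * q := by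
          simp [Matrix.mul_sum, Matrix.sum_mul, Matrix.mul_assoc, star_eq_conjTranspose]
      _ = q := by rw [hw1, hqs, mul_one, hq]
  have hv (l) : p * (w l * q) = w l * q := by rw [← Matrix.mul_assoc, hw]
  obtain ⟨K, s, hs, hss, hiso, hsτ⟩ := exists_projection_of_corner_starAlgEquiv hq hqs φ.symm hψ
    hψ_mul hψ_star hv hvq fun l => by rw [Matrix.mul_assoc, hq]
  have hvmem (l) : (w l * q) * (w l * q)ᴴ ∈ corner p hp hps := by
    refine ⟨by rw [← Matrix.mul_assoc, hv], ?_⟩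
    conv_lhs => rw [← hps, Matrix.mul_assoc, star_eq_conjTranspose, ← conjTranspose_mul, hv]
  obtain ⟨c, hc⟩ := exists_eq_mul_matTrace hsimple hτ huniq hp hps hpne (matTrace τ ∘ₗ ψ)
    (fun x hx => by
      rw [LinearMap.comp_apply, hψ_mul _ (star_mem hx) _ hx, hψ_star _ hx]
      exact matTrace_conjTranspose_mul_self_nonneg hτ _)
    (fun x hx y hy => by
      rw [LinearMap.comp_apply, LinearMap.comp_apply, hψ_mul _ hx _ hy, hψ_mul _ hy _ hx,
        matTrace_mul_comm hτ])
  have hψp : ψ p = r := by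
    let P : corner p hp hps := ⟨p, hp, hp⟩
    let R : corner r hr hrs := ⟨r, hr, hr⟩
    have h1 : φ.symm P * R = φ.symm P := Subtype.ext (φ.symm P).2.2
    have h2 : P * φ R = φ R := Subtype.ext (φ R).2.1
    have h3 := congrArg φ.symm h2
    rw [map_mul, StarAlgEquiv.symm_apply_apply, h1] at h3
    exact (hψ P).trans (congrArg Subtype.val h3)
  have hpτ := matTrace_re_ne_zero hsimple hτ hp hps hpne
  have hqτ := matTrace_re_ne_zero hsimple hτ hq hqs hqne
  have hcr : matTrace τ r = c * matTrace τ p := by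
    rw [← hc p ⟨hp, hp⟩, LinearMap.comp_apply, hψp]
  have hcs : matTrace τ s = c * matTrace τ q := by
    rw [hsτ]
    conv_rhs => rw [← hvq, map_sum, Finset.mul_sum]
    refine Finset.sum_congr rfl fun l _ => ?_
    rw [matTrace_mul_comm hτ (w l * q)ᴴ, ← hc _ (hvmem l), LinearMap.comp_apply]
  refine ⟨K, s, hs, hss, ?_, hiso, ?_⟩
  · rintro rfl
    obtain ⟨e⟩ := hiso
    refine hqne ?_
    have h0 : e.symm ⟨q, hq, hq⟩ = 0 := by
      refine Subtype.ext ?_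
      have := (e.symm ⟨q, hq, hq⟩).2.1
      rw [zero_mul] at this
      exact this.symm
    exact congrArg Subtype.val ((map_eq_zero_iff e.symm (EquivLike.injective e.symm)).1 h0)
  · simp only [← matTrace_apply, hcr, hcs, Complex.re_ofReal_mul]
    rw [mul_div_cancel_right₀ _ hpτ, mul_div_cancel_right₀ _ hqτ]

end RelFundGroup

/-- Let `A` be a simple unital C*-algebra with a unique tracial state `τ`, and let
`p ∈ M_n(A)` and `q ∈ M_m(A)` be nonzero projections. Then `𝓕_p(A) = 𝓕_q(A)`. -/
theorem relFundGroup_eq {A : Type*} [CStarAlgebra A] [Nontrivial A]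
    (hsimple : ∀ I : TwoSidedIdeal A, IsClosed (I : Set A) → I = ⊥ ∨ I = ⊤)
    (τ : A →L[ℂ] ℂ) (hτ : IsTracialState τ)
    (huniq : ∀ σ : A →L[ℂ] ℂ, IsTracialState σ → σ = τ)
    {n m : ℕ} (p : Matrix (Fin n) (Fin n) A) (hp : p * p = p) (hps : star p = p) (hpne : p ≠ 0)
    (q : Matrix (Fin m) (Fin m) A) (hq : q * q = q) (hqs : star q = q) (hqne : q ≠ 0) :
    relFundGroup τ p hp hps = relFundGroup τ q hq hqs := by
  exact (RelFundGroup.relFundGroup_subset hsimple τ hτ huniq p hp hps hpne q hq hqs hqne).antisymm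
    (RelFundGroup.relFundGroup_subset hsimple τ hτ huniq q hq hqs hqne p hp hps hpne)
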